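/- arXiv:gr-qc/0006035 — 2 statements merged into one kernel-verified Lean document; each statement's English description precedes it below -/
import Mathlib

section
/- Let 2/3 < γ < 2. Every Bianchi type IX solution of the Wainwright–Hsu system has a nonempty α-limit set. -/
open Real Filter Topology Set

noncomputable section

namespace WainwrightHsu

/-- The deceleration parameter `q` of the Wainwright–Hsu system. -/
def qf (γ O Sp Sm : ℝ) : ℝ := (1/2) * (3*γ - 2) * O + 2 * (Sp^2 + Sm^2)

/-- The curvature term `S₊`. -/
def SPf (n1 n2 n3 : ℝ) : ℝ := (1/2) * ((n2 - n3)^2 - n1 * (2*n1 - n2 - n3))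

/-- The curvature term `S₋`. -/
def SMf (n1 n2 n3 : ℝ) : ℝ := (Real.sqrt 3 / 2) * (n3 - n2) * (n1 - n2 - n3)

/-- The Hamiltonian constraint. -/
def Constraint (O Sp Sm n1 n2 n3 : ℝ) : Prop :=
  O + Sp^2 + Sm^2 + (3/4) * (n1^2 + n2^2 + n3^2 - 2*(n1*n2 + n2*n3 + n3*n1)) = 1

/-- `(O, Sp, Sm, n1, n2, n3)` is a solution of the Wainwright–Hsu system (with
parameter `γ`) on the set `s ⊆ ℝ`, satisfying `Ω ≥ 0` and the constraint. -/
structure SolOn (γ : ℝ) (s : Set ℝ) (O Sp Sm n1 n2 n3 : ℝ → ℝ) : Prop where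
  hn1 : ∀ τ ∈ s, HasDerivAt n1 ((qf γ (O τ) (Sp τ) (Sm τ) - 4 * Sp τ) * n1 τ) τ
  hn2 : ∀ τ ∈ s, HasDerivAt n2
    ((qf γ (O τ) (Sp τ) (Sm τ) + 2 * Sp τ + 2 * Real.sqrt 3 * Sm τ) * n2 τ) τ
  hn3 : ∀ τ ∈ s, HasDerivAt n3
    ((qf γ (O τ) (Sp τ) (Sm τ) + 2 * Sp τ - 2 * Real.sqrt 3 * Sm τ) * n3 τ) τ
  hSp : ∀ τ ∈ s, HasDerivAt Sp
    (-(2 - qf γ (O τ) (Sp τ) (Sm τ)) * Sp τ - 3 * SPf (n1 τ) (n2 τ) (n3 τ)) τ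
  hSm : ∀ τ ∈ s, HasDerivAt Sm
    (-(2 - qf γ (O τ) (Sp τ) (Sm τ)) * Sm τ - 3 * SMf (n1 τ) (n2 τ) (n3 τ)) τ
  hO : ∀ τ ∈ s, HasDerivAt O ((2 * qf γ (O τ) (Sp τ) (Sm τ) - (3*γ - 2)) * O τ) τ
  hOnn : ∀ τ ∈ s, 0 ≤ O τ
  hcon : ∀ τ ∈ s, Constraint (O τ) (Sp τ) (Sm τ) (n1 τ) (n2 τ) (n3 τ)

/-- The solution is of Taub type. -/
def TaubType (s : Set ℝ) (Sp Sm n1 n2 n3 : ℝ → ℝ) : Prop :=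
  (∀ τ ∈ s, Sm τ = 0 ∧ n2 τ = n3 τ) ∨
  (∀ τ ∈ s, Sm τ = -(Real.sqrt 3) * Sp τ ∧ n1 τ = n2 τ) ∨
  (∀ τ ∈ s, Sm τ = Real.sqrt 3 * Sp τ ∧ n3 τ = n1 τ)

/-- The solution converges to the fixed point `F` as `τ → -∞`. -/
def TendstoF (O Sp Sm n1 n2 n3 : ℝ → ℝ) : Prop :=
  Tendsto O atBot (𝓝 1) ∧ Tendsto Sp atBot (𝓝 0) ∧ Tendsto Sm atBot (𝓝 0) ∧
  Tendsto n1 atBot (𝓝 0) ∧ Tendsto n2 atBot (𝓝 0) ∧ Tendsto n3 atBot (𝓝 0)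

/-- The solution converges to the fixed point `P₁⁺(II)` as `τ → -∞`. -/
def TendstoP1 (γ : ℝ) (O Sp Sm n1 n2 n3 : ℝ → ℝ) : Prop :=
  Tendsto O atBot (𝓝 (1 - (3*γ - 2)/16)) ∧
  Tendsto Sp atBot (𝓝 ((3*γ - 2)/8)) ∧ Tendsto Sm atBot (𝓝 0) ∧
  (∃ c : ℝ, 0 < c ∧ Tendsto n1 atBot (𝓝 c)) ∧
  Tendsto n2 atBot (𝓝 0) ∧ Tendsto n3 atBot (𝓝 0)

/-- The solution converges to the fixed point `P₂⁺(II)` as `τ → -∞`. -/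
def TendstoP2 (γ : ℝ) (O Sp Sm n1 n2 n3 : ℝ → ℝ) : Prop :=
  Tendsto O atBot (𝓝 (1 - (3*γ - 2)/16)) ∧
  Tendsto Sp atBot (𝓝 (-((3*γ - 2)/16))) ∧
  Tendsto Sm atBot (𝓝 (-(Real.sqrt 3 * (3*γ - 2)/16))) ∧
  Tendsto n1 atBot (𝓝 0) ∧
  (∃ c : ℝ, 0 < c ∧ Tendsto n2 atBot (𝓝 c)) ∧ Tendsto n3 atBot (𝓝 0)

/-- The solution converges to the fixed point `P₃⁺(II)` as `τ → -∞`. -/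
def TendstoP3 (γ : ℝ) (O Sp Sm n1 n2 n3 : ℝ → ℝ) : Prop :=
  Tendsto O atBot (𝓝 (1 - (3*γ - 2)/16)) ∧
  Tendsto Sp atBot (𝓝 (-((3*γ - 2)/16))) ∧
  Tendsto Sm atBot (𝓝 (Real.sqrt 3 * (3*γ - 2)/16)) ∧
  Tendsto n1 atBot (𝓝 0) ∧ Tendsto n2 atBot (𝓝 0) ∧
  (∃ c : ℝ, 0 < c ∧ Tendsto n3 atBot (𝓝 c))

/-- A Bianchi IX solution is generic if it is not of Taub type and does not
converge to `F` nor to any of the `Pᵢ⁺(II)` as `τ → -∞`. -/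
def Generic (γ : ℝ) (s : Set ℝ) (O Sp Sm n1 n2 n3 : ℝ → ℝ) : Prop :=
  ¬ TaubType s Sp Sm n1 n2 n3 ∧ ¬ TendstoF O Sp Sm n1 n2 n3 ∧
  ¬ TendstoP1 γ O Sp Sm n1 n2 n3 ∧ ¬ TendstoP2 γ O Sp Sm n1 n2 n3 ∧
  ¬ TendstoP3 γ O Sp Sm n1 n2 n3

/-- `(a, b, c, d, e, f)` is an α-limit point of the solution:
some sequence of times tending to `-∞` along which the solution converges to it. -/
def AlphaLim (O Sp Sm n1 n2 n3 : ℝ → ℝ) (a b c d e f : ℝ) : Prop :=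
  ∃ τs : ℕ → ℝ, Tendsto τs atTop atBot ∧
    Tendsto (fun k => O (τs k)) atTop (𝓝 a) ∧
    Tendsto (fun k => Sp (τs k)) atTop (𝓝 b) ∧
    Tendsto (fun k => Sm (τs k)) atTop (𝓝 c) ∧
    Tendsto (fun k => n1 (τs k)) atTop (𝓝 d) ∧
    Tendsto (fun k => n2 (τs k)) atTop (𝓝 e) ∧
    Tendsto (fun k => n3 (τs k)) atTop (𝓝 f)

/-- ω-limit point (times tending to `+∞`). -/
def OmegaLim (O Sp Sm n1 n2 n3 : ℝ → ℝ) (a b c d e f : ℝ) : Prop :=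
  ∃ τs : ℕ → ℝ, Tendsto τs atTop atTop ∧
    Tendsto (fun k => O (τs k)) atTop (𝓝 a) ∧
    Tendsto (fun k => Sp (τs k)) atTop (𝓝 b) ∧
    Tendsto (fun k => Sm (τs k)) atTop (𝓝 c) ∧
    Tendsto (fun k => n1 (τs k)) atTop (𝓝 d) ∧
    Tendsto (fun k => n2 (τs k)) atTop (𝓝 e) ∧
    Tendsto (fun k => n3 (τs k)) atTop (𝓝 f)

/-- α-limit point, phrased for a point of `ℝ⁶` (in coordinates `Ω, Σ₊, Σ₋, N₁, N₂, N₃`). -/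
def AlphaLimPt (O Sp Sm n1 n2 n3 : ℝ → ℝ) (p : Fin 6 → ℝ) : Prop :=
  ∃ τs : ℕ → ℝ, Tendsto τs atTop atBot ∧
    Tendsto (fun k =>
      (![O (τs k), Sp (τs k), Sm (τs k), n1 (τs k), n2 (τs k), n3 (τs k)] : Fin 6 → ℝ))
      atTop (𝓝 p)

/-- A non-special point of the Kasner circle, given by its `(Σ₊, Σ₋)` coordinates. -/
def NonSpecialKasner (a b : ℝ) : Prop :=
  a^2 + b^2 = 1 ∧ (a, b) ≠ (-1, 0) ∧
  (a, b) ≠ (1/2, Real.sqrt 3 / 2) ∧ (a, b) ≠ (1/2, -(Real.sqrt 3) / 2)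

/-- The state vector of a solution, as a point of Euclidean `ℝ⁶`. -/
def stateVec (O Sp Sm n1 n2 n3 : ℝ → ℝ) (τ : ℝ) : EuclideanSpace ℝ (Fin 6) :=
  (WithLp.equiv 2 (Fin 6 → ℝ)).symm ![O τ, Sp τ, Sm τ, n1 τ, n2 τ, n3 τ]

/-- The Bianchi attractor `𝒜`: the closure of the vacuum type I and II points, i.e. the
points of `ℝ⁶` satisfying the constraint with `Ω = 0` and `N₁N₂ = N₂N₃ = N₃N₁ = 0`. -/
def attractor : Set (EuclideanSpace ℝ (Fin 6)) :=
  {y | Constraint (y 0) (y 1) (y 2) (y 3) (y 4) (y 5) ∧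
    y 0 = 0 ∧ y 3 * y 4 = 0 ∧ y 4 * y 5 = 0 ∧ y 5 * y 3 = 0}


/-- Cyclic symmetry of the system. -/
lemma SolOn.rot {γ : ℝ} {s : Set ℝ} {O Sp Sm n1 n2 n3 : ℝ → ℝ}
    (h : SolOn γ s O Sp Sm n1 n2 n3) :
    SolOn γ s O (fun t => -(1/2) * Sp t - (Real.sqrt 3 / 2) * Sm t)
      (fun t => (Real.sqrt 3 / 2) * Sp t - (1/2) * Sm t) n2 n3 n1 := by
  have h3 : Real.sqrt 3 ^ 2 = 3 := Real.sq_sqrt (by norm_num)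
  have hq : ∀ o x y : ℝ, qf γ o (-(1/2) * x - (Real.sqrt 3 / 2) * y)
      ((Real.sqrt 3 / 2) * x - (1/2) * y) = qf γ o x y := by
    intro o x y
    unfold qf
    linear_combination (x^2 + y^2) / 2 * h3
  refine ⟨?_, ?_, ?_, ?_, ?_, ?_, h.hOnn, ?_⟩
  · intro τ hτ
    simp only [hq]
    refine HasDerivAt.congr_deriv (h.hn2 τ hτ) ?_
    ring
  · intro τ hτ
    simp only [hq]
    refine HasDerivAt.congr_deriv (h.hn3 τ hτ) ?_
    linear_combination -(Sp τ * n3 τ) * h3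
  · intro τ hτ
    simp only [hq]
    refine HasDerivAt.congr_deriv (h.hn1 τ hτ) ?_
    linear_combination (Sp τ * n1 τ) * h3
  · intro τ hτ
    simp only [hq]
    refine HasDerivAt.congr_deriv (((h.hSp τ hτ).const_mul (-(1/2))).sub ((h.hSm τ hτ).const_mul (Real.sqrt 3 / 2))) ?_
    unfold SPf SMf
    linear_combination (3/4 * (n3 τ - n2 τ) * (n1 τ - n2 τ - n3 τ)) * h3
  · intro τ hτ
    simp only [hq]
    refine HasDerivAt.congr_deriv (((h.hSp τ hτ).const_mul (Real.sqrt 3 / 2)).sub ((h.hSm τ hτ).const_mul (1/2))) ?_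
    unfold SPf SMf
    ring
  · intro τ hτ
    simp only [hq]
    exact h.hO τ hτ
  · intro τ hτ
    have := h.hcon τ hτ
    unfold Constraint at this ⊢
    linear_combination this + (Sp τ^2 + Sm τ^2) / 4 * h3

/-- Monotonicity on a past half line from a nonnegative derivative. -/
lemma mono_of_deriv {T : ℝ} {f f' : ℝ → ℝ}
    (hf : ∀ t ∈ Set.Iic T, HasDerivAt f (f' t) t) (h0 : ∀ t ∈ Set.Iic T, 0 ≤ f' t) :
    MonotoneOn f (Set.Iic T) := by
  refine monotoneOn_of_hasDerivWithinAt_nonneg (convex_Iic T)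
    (fun t ht => (hf t ht).continuousAt.continuousWithinAt)
    (fun t ht => (hf t (interior_subset ht)).hasDerivWithinAt)
    (fun t ht => h0 t (interior_subset ht))

lemma qf_nonneg {γ O x y : ℝ} (hγ : 2/3 < γ) (hO : 0 ≤ O) : 0 ≤ qf γ O x y := by
  unfold qf
  have : 0 ≤ (3*γ - 2) * O := mul_nonneg (by linarith) hO
  nlinarith [sq_nonneg x, sq_nonneg y]

lemma prod_deriv {γ : ℝ} {s : Set ℝ} {O Sp Sm n1 n2 n3 : ℝ → ℝ}
    (h : SolOn γ s O Sp Sm n1 n2 n3) : ∀ t ∈ s, HasDerivAt (fun t => n1 t * (n2 t * n3 t))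
      (3 * qf γ (O t) (Sp t) (Sm t) * (n1 t * (n2 t * n3 t))) t := by
  intro t ht
  refine HasDerivAt.congr_deriv ((h.hn1 t ht).mul ((h.hn2 t ht).mul (h.hn3 t ht))) ?_
  try simp only [Pi.mul_apply]
  ring

lemma prod_mono {γ T : ℝ} (hγ : 2/3 < γ) {O Sp Sm n1 n2 n3 : ℝ → ℝ}
    (h : SolOn γ (Set.Iic T) O Sp Sm n1 n2 n3)
    (hpos : ∀ τ ∈ Set.Iic T, 0 < n1 τ ∧ 0 < n2 τ ∧ 0 < n3 τ) :
    MonotoneOn (fun t => n1 t * (n2 t * n3 t)) (Set.Iic T) := by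
  refine mono_of_deriv (prod_deriv h) ?_
  intro t ht
  obtain ⟨h1, h2, h3⟩ := hpos t ht
  have := qf_nonneg (x := Sp t) (y := Sm t) hγ (h.hOnn t ht)
  positivity

set_option maxHeartbeats 1000000 in
/-- `N₁` cannot stay below one while `N₂ N₃ → ∞`. -/
lemma main_false (γ T : ℝ) (hγ : 2/3 < γ) (O Sp Sm n1 n2 n3 : ℝ → ℝ)
    (h : SolOn γ (Set.Iic T) O Sp Sm n1 n2 n3)
    (hp1 : ∀ τ ∈ Set.Iic T, 0 < n1 τ) (hn1 : ∀ τ ∈ Set.Iic T, n1 τ < 1)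
    (hn2 : ∀ τ ∈ Set.Iic T, 1 < n2 τ) (hn3 : ∀ τ ∈ Set.Iic T, 1 < n3 τ)
    (hP : Tendsto (fun t => n2 t * n3 t) atBot atTop) : False := by
  have hpos : ∀ τ ∈ Set.Iic T, 0 < n1 τ ∧ 0 < n2 τ ∧ 0 < n3 τ := fun τ hτ =>
    ⟨hp1 τ hτ, by linarith [hn2 τ hτ], by linarith [hn3 τ hτ]⟩
  have hnobd : ∀ B, ¬ ∀ τ ∈ Set.Iic T, n2 τ * n3 τ ≤ B := by
    intro B hB
    obtain ⟨t, ht1, ht2⟩ := ((hP.eventually_gt_atTop B).and (eventually_le_atBot T)).exists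
    exact absurd (hB t ht2) (not_le.mpr ht1)
  have hTT : T ∈ Set.Iic T := Set.self_mem_Iic
  set C := n1 T * (n2 T * n3 T) with hC
  have hC0 : 0 < C := by
    obtain ⟨a, b, c⟩ := hpos T hTT
    positivity
  have hmono := prod_mono hγ h hpos
  have hle : ∀ τ ∈ Set.Iic T, n1 τ * (n2 τ * n3 τ) ≤ C := fun τ hτ => hmono hτ hTT hτ
  -- n1 (n2+n3) ≤ 2 eps
  have hb : ∀ τ ∈ Set.Iic T, n1 τ * (n2 τ + n3 τ) ≤ 2 * (n1 τ * (n2 τ * n3 τ)) := by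
    intro τ hτ
    have h1 := hp1 τ hτ
    have : n2 τ + n3 τ ≤ 2 * (n2 τ * n3 τ) := by nlinarith [hn2 τ hτ, hn3 τ hτ]
    nlinarith
  have hbe : ∀ τ ∈ Set.Iic T, n1 τ ≤ n1 τ * (n2 τ * n3 τ) := by
    intro τ hτ
    have h1 := hp1 τ hτ
    have : 1 ≤ n2 τ * n3 τ := by nlinarith [hn2 τ hτ, hn3 τ hτ]
    nlinarith
  have hcon : ∀ τ ∈ Set.Iic T, O τ + Sp τ^2 + Sm τ^2 + (3/4) * (n2 τ - n3 τ)^2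
      = 1 + (3/2) * (n1 τ * (n2 τ + n3 τ)) - (3/4) * n1 τ^2 := by
    intro τ hτ
    have := h.hcon τ hτ
    unfold Constraint at this
    linear_combination this
  have hcon2 : ∀ τ ∈ Set.Iic T, O τ + Sp τ^2 + Sm τ^2 + (3/4) * (n2 τ - n3 τ)^2
      ≤ 1 + 3 * (n1 τ * (n2 τ * n3 τ)) := by
    intro τ hτ
    nlinarith [hcon τ hτ, hb τ hτ, sq_nonneg (n1 τ)]
  set K := 1 + 3 * C with hK
  have hK1 : 1 ≤ K := by linarith
  have hKb : ∀ τ ∈ Set.Iic T, O τ + Sp τ^2 + Sm τ^2 + (3/4) * (n2 τ - n3 τ)^2 ≤ K := by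
    intro τ hτ
    linarith [hcon2 τ hτ, hle τ hτ]
  have hSpK : ∀ τ ∈ Set.Iic T, |Sp τ| ≤ K := by
    intro τ hτ
    refine abs_le_of_sq_le_sq ?_ (by linarith)
    nlinarith [hKb τ hτ, h.hOnn τ hτ, sq_nonneg (Sm τ), sq_nonneg (n2 τ - n3 τ)]
  have hy : ∀ τ ∈ Set.Iic T, -(3/2) * (n1 τ * (n2 τ * n3 τ)) ≤ 1 + Sp τ := by
    intro τ hτ
    by_contra hc
    push Not at hc
    have h1 := hcon2 τ hτ
    have h2 : 0 < n1 τ * (n2 τ * n3 τ) := lt_of_lt_of_le (hp1 τ hτ) (hbe τ hτ)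
    nlinarith [h.hOnn τ hτ, sq_nonneg (Sm τ), sq_nonneg (n2 τ - n3 τ)]
  -- exponential decay
  obtain ⟨c, D, hc, hD, hdec⟩ : ∃ c D : ℝ, 0 < c ∧ 0 < D ∧
      ∀ τ ∈ Set.Iic T, n1 τ * (n2 τ * n3 τ) ≤ D * Real.exp (c * τ) := by
    have hk : 0 < 3*γ - 2 := by linarith
    set A := K + 4 / (3*γ - 2) + 2 with hA
    have hA0 : 0 < A := by positivity
    have hd : ∀ t ∈ Set.Iic T, HasDerivAt
        (fun t => A * Real.log (n1 t * (n2 t * n3 t)) - Sp t - t)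
        (A * (3 * qf γ (O t) (Sp t) (Sm t))
          - (-(2 - qf γ (O t) (Sp t) (Sm t)) * Sp t - 3 * SPf (n1 t) (n2 t) (n3 t)) - 1) t := by
      intro t ht
      have hne : n1 t * (n2 t * n3 t) ≠ 0 := by
        obtain ⟨a, b, c⟩ := hpos t ht
        positivity
      refine HasDerivAt.congr_deriv (((((prod_deriv h t ht).log hne).const_mul A).sub (h.hSp t ht)).sub (hasDerivAt_id t)) ?_
      rw [mul_div_assoc, div_self hne, mul_one]
    have hm := mono_of_deriv hd (by
      intro t ht
      have hO := h.hOnn t ht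
      have hq0 := qf_nonneg (x := Sp t) (y := Sm t) hγ hO
      have hco := hcon t ht
      have hS : 2 * (1 - O t - Sp t^2 - Sm t^2) ≤ 3 * SPf (n1 t) (n2 t) (n3 t) := by
        unfold SPf
        nlinarith [hp1 t ht, hn1 t ht, hn2 t ht, hn3 t ht,
          mul_pos (hp1 t ht) (show 0 < n2 t + n3 t - n1 t by
            linarith [hn1 t ht, hn2 t ht, hn3 t ht])]
      have hqS : qf γ (O t) (Sp t) (Sm t) * Sp t ≤ qf γ (O t) (Sp t) (Sm t) * K :=
        mul_le_mul_of_nonneg_left ((le_abs_self _).trans (hSpK t ht)) hq0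
      have hqO : 2 * O t ≤ (4 / (3*γ - 2)) * qf γ (O t) (Sp t) (Sm t) := by
        rw [div_mul_eq_mul_div, le_div_iff₀ hk]
        unfold qf
        nlinarith [sq_nonneg (Sp t), sq_nonneg (Sm t)]
      have hq2 : 2 * (Sp t^2 + Sm t^2) ≤ qf γ (O t) (Sp t) (Sm t) := by
        unfold qf
        nlinarith [mul_nonneg hk.le hO]
      have hAq : A * qf γ (O t) (Sp t) (Sm t) = qf γ (O t) (Sp t) (Sm t) * K
          + (4 / (3*γ - 2)) * qf γ (O t) (Sp t) (Sm t) + 2 * qf γ (O t) (Sp t) (Sm t) := by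
        rw [hA]; ring
      have hAq0 : 0 ≤ A * qf γ (O t) (Sp t) (Sm t) := by positivity
      nlinarith [sq_nonneg (1 + Sp t), sq_nonneg (Sm t)])
    refine ⟨1 / A, Real.exp ((A * Real.log (n1 T * (n2 T * n3 T)) - Sp T - T + K) / A),
      by positivity, Real.exp_pos _, ?_⟩
    intro τ hτ
    have h1 := hm hτ hTT hτ
    simp only at h1
    have h2 := (le_abs_self _).trans (hSpK τ hτ)
    have hpp : 0 < n1 τ * (n2 τ * n3 τ) := lt_of_lt_of_le (hp1 τ hτ) (hbe τ hτ)
    rw [← Real.exp_add, ← Real.log_le_iff_le_exp hpp, ← mul_le_mul_iff_right₀ hA0]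
    have : A * ((A * Real.log (n1 T * (n2 T * n3 T)) - Sp T - T + K) / A + 1 / A * τ)
      = (A * Real.log (n1 T * (n2 T * n3 T)) - Sp T - T + K) + τ := by
      field_simp
    rw [this]
    linarith
  have hexpd : ∀ t, HasDerivAt (fun t => Real.exp (c * t)) (Real.exp (c * t) * c) t := by
    intro t
    have := ((hasDerivAt_id t).const_mul c).exp
    simpa using this
  have hPd : ∀ t ∈ Set.Iic T, HasDerivAt (fun t => n2 t * n3 t)
      ((2 * qf γ (O t) (Sp t) (Sm t) + 4 * Sp t) * (n2 t * n3 t)) t := by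
    intro t ht
    refine HasDerivAt.congr_deriv ((h.hn2 t ht).mul (h.hn3 t ht)) ?_
    ring
  by_cases hE : ∃ t0 ∈ Set.Iic T, Sm t0^2 + (3/4) * (n2 t0 - n3 t0)^2 ≠ 0
  · obtain ⟨t0, ht0, hE0⟩ := hE
    have h3 : Real.sqrt 3 ^ 2 = 3 := Real.sq_sqrt (by norm_num)
    have hEd : ∀ t ∈ Set.Iic T, HasDerivAt (fun t => Sm t^2 + (3/4) * (n2 t - n3 t)^2)
        ((2 * qf γ (O t) (Sp t) (Sm t) + 4 * Sp t) * (Sm t^2 + (3/4) * (n2 t - n3 t)^2)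
          + (-4 * (1 + Sp t) * Sm t^2 + 3 * Real.sqrt 3 * Sm t * (n2 t - n3 t) * n1 t)) t := by
      intro t ht
      refine HasDerivAt.congr_deriv (((h.hSm t ht).pow 2).add ((((h.hn2 t ht).sub (h.hn3 t ht)).pow 2).const_mul (3/4))) ?_
      unfold SMf
      try simp only [Pi.sub_apply]
      push_cast
      ring
    have hZd : ∀ t ∈ Set.Iic T, HasDerivAt
        (fun t => -((Sm t^2 + (3/4) * (n2 t - n3 t)^2) / (n2 t * n3 t)
          * Real.exp (-(9 * D / c) * Real.exp (c * t))))
        ((9 * D * Real.exp (c * t) * (Sm t^2 + (3/4) * (n2 t - n3 t)^2)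
          - (-4 * (1 + Sp t) * Sm t^2 + 3 * Real.sqrt 3 * Sm t * (n2 t - n3 t) * n1 t))
          / (n2 t * n3 t) * Real.exp (-(9 * D / c) * Real.exp (c * t))) t := by
      intro t ht
      obtain ⟨_, p2, p3⟩ := hpos t ht
      have hne : n2 t * n3 t ≠ 0 := by positivity
      refine HasDerivAt.congr_deriv ((((hEd t ht).div (hPd t ht) hne).mul
        (((hexpd t).const_mul (-(9 * D / c))).exp)).neg) ?_
      try simp only [Pi.div_apply]
      field_simp
      ring
    have hm := mono_of_deriv hZd (by
      intro t ht
      obtain ⟨p1, p2, p3⟩ := hpos t ht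
      refine mul_nonneg (div_nonneg ?_ (by positivity)) (Real.exp_pos _).le
      have e1 := hdec t ht
      have e2 := hy t ht
      have e3 := hbe t ht
      set ε := n1 t * (n2 t * n3 t)
      set x := Sm t
      set a := n2 t - n3 t
      have f1 : 9 * ε * (x^2 + (3/4) * a^2) ≤ 9 * D * Real.exp (c * t) * (x^2 + (3/4) * a^2) := by
        have : 0 ≤ x^2 + (3/4) * a^2 := by positivity
        nlinarith
      have f2 : -4 * (1 + Sp t) * x^2 ≤ 6 * ε * x^2 := by
        nlinarith [sq_nonneg x]
      have f3 : 3 * Real.sqrt 3 * x * a * n1 t ≤ 3 * (x^2 + (3/4) * a^2) * n1 t := by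
        refine mul_le_mul_of_nonneg_right ?_ p1.le
        nlinarith [sq_nonneg (x - Real.sqrt 3 / 2 * a)]
      have f4 : 3 * (x^2 + (3/4) * a^2) * n1 t ≤ 3 * (x^2 + (3/4) * a^2) * ε :=
        mul_le_mul_of_nonneg_left e3 (by positivity)
      have f5 : 0 ≤ ε * a^2 := mul_nonneg (p1.le.trans e3) (sq_nonneg a)
      linarith)
    obtain ⟨_, p2, p3⟩ := hpos t0 ht0
    set h0 := (Sm t0^2 + (3/4) * (n2 t0 - n3 t0)^2) / (n2 t0 * n3 t0)
          * Real.exp (-(9 * D / c) * Real.exp (c * t0)) with hh0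
    have h0pos : 0 < h0 := by
      have : 0 < Sm t0^2 + (3/4) * (n2 t0 - n3 t0)^2 := lt_of_le_of_ne (by positivity) hE0.symm
      positivity
    obtain ⟨t, ht1, ht2⟩ := ((hP.eventually_gt_atTop (K / h0)).and (eventually_le_atBot t0)).exists
    have ht : t ∈ Set.Iic T := le_trans ht2 ht0
    have hm' := hm ht ht0 ht2
    simp only at hm'
    rw [← hh0] at hm'
    obtain ⟨_, p2, p3⟩ := hpos t ht
    have hpp : 0 < n2 t * n3 t := by positivity
    have hZ0 : 0 ≤ (Sm t^2 + (3/4) * (n2 t - n3 t)^2) / (n2 t * n3 t) := by positivity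
    have hex : Real.exp (-(9 * D / c) * Real.exp (c * t)) ≤ 1 := by
      rw [Real.exp_le_one_iff]
      have : 0 < (9 * D / c) * Real.exp (c * t) := by positivity
      linarith
    have hfin : h0 ≤ (Sm t^2 + (3/4) * (n2 t - n3 t)^2) / (n2 t * n3 t) := by
      have := mul_le_of_le_one_right hZ0 hex
      linarith
    rw [le_div_iff₀ hpp] at hfin
    rw [div_lt_iff₀ h0pos] at ht1
    nlinarith [hKb t ht, h.hOnn t ht, sq_nonneg (Sp t)]
  · push Not at hE
    have hz : ∀ t ∈ Set.Iic T, Sm t = 0 ∧ n2 t = n3 t := by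
      intro t ht
      have := hE t ht
      constructor
      · nlinarith [sq_nonneg (n2 t - n3 t), sq_nonneg (Sm t), this]
      · nlinarith [sq_nonneg (n2 t - n3 t), sq_nonneg (Sm t), this]
    set L := 3 * ((3*γ - 2) * K / 2 + 2 * K) + 6 with hL
    have hk : 0 < 3*γ - 2 := by linarith
    have hL0 : 0 < L := by positivity
    have hd : ∀ t ∈ Set.Iic T, HasDerivAt
        (fun t => Real.log (n2 t * n3 t) + 2 * Sp t + (L * D / c) * Real.exp (c * t))
        ((2 * qf γ (O t) (Sp t) (Sm t) + 4 * Sp t)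
          + 2 * (-(2 - qf γ (O t) (Sp t) (Sm t)) * Sp t - 3 * SPf (n1 t) (n2 t) (n3 t))
          + L * D * Real.exp (c * t)) t := by
      intro t ht
      obtain ⟨_, p2, p3⟩ := hpos t ht
      have hne : n2 t * n3 t ≠ 0 := by positivity
      refine HasDerivAt.congr_deriv ((((hPd t ht).log hne).add ((h.hSp t ht).const_mul 2)).add
        ((hexpd t).const_mul (L * D / c))) ?_
      field_simp
    have hm := mono_of_deriv hd (by
      intro t ht
      have hO := h.hOnn t ht
      have hq0 := qf_nonneg (x := Sp t) (y := Sm t) hγ hO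
      have e1 := hdec t ht
      have e2 := hy t ht
      have e3 := hbe t ht
      have e4 := hb t ht
      have p1 := hp1 t ht
      have hq1 : qf γ (O t) (Sp t) (Sm t) ≤ (3*γ - 2) * K / 2 + 2 * K := by
        have := hKb t ht
        have hOK : O t ≤ K := by
          linarith [sq_nonneg (Sp t), sq_nonneg (Sm t), sq_nonneg (n2 t - n3 t)]
        have h1 := mul_le_mul_of_nonneg_left hOK hk.le
        have h2 := sq_nonneg (n2 t - n3 t)
        have h3 : 2 * (Sp t^2 + Sm t^2) ≤ 2 * K := by linarith
        unfold qf
        linarith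
      have hS : 6 * SPf (n1 t) (n2 t) (n3 t) ≤ 3 * (n1 t * (n2 t + n3 t)) := by
        unfold SPf
        rw [(hz t ht).2]
        nlinarith [sq_nonneg (n1 t)]
      set q := qf γ (O t) (Sp t) (Sm t)
      set ε := n1 t * (n2 t * n3 t)
      have g1 : q * (-(3/2) * ε) ≤ q * (1 + Sp t) := mul_le_mul_of_nonneg_left e2 hq0
      have g2 : q * ε ≤ ((3*γ - 2) * K / 2 + 2 * K) * ε :=
        mul_le_mul_of_nonneg_right hq1 (p1.le.trans e3)
      have g3 : L * ε ≤ L * (D * Real.exp (c * t)) := mul_le_mul_of_nonneg_left e1 hL0.le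
      rw [hL] at g3 ⊢
      linarith)
    set J := Real.log (n2 T * n3 T) + 2 * Sp T + (L * D / c) * Real.exp (c * T) with hJ
    refine hnobd (Real.exp (J + 2 * K)) ?_
    intro t ht
    have hm' := hm ht hTT ht
    simp only at hm'
    rw [← hJ] at hm'
    obtain ⟨_, p2, p3⟩ := hpos t ht
    rw [← Real.log_le_iff_le_exp (by positivity)]
    have h1 := (abs_le.mp (hSpK t ht)).1
    have h2 : 0 < (L * D / c) * Real.exp (c * t) := by positivity
    linarith

lemma order_aux {x y z C : ℝ} (hC : 0 < C) (hx : 0 < x) (hxy : x ≤ y) (hyz : y ≤ z)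
    (hp : x * (y * z) ≤ C) (hs : 3 * C + 31 ≤ x + y + z)
    (hq : (3/4) * (x^2 + y^2 + z^2 - 2*(x*y + y*z + z*x)) ≤ 1) : x < 1 ∧ 1 < y ∧ 1 < z := by
  have hz : C + 31/3 ≤ z := by linarith
  have hy : z ≤ 10 * y := by
    by_contra hc
    push Not at hc
    have h1 : x * y ≤ z / 10 * (z / 10) := mul_le_mul (by linarith) (by linarith)
      (by linarith) (by linarith)
    nlinarith [mul_le_mul_of_nonneg_right (show y ≤ z / 10 by linarith) (show 0 ≤ z by linarith),
      mul_le_mul_of_nonneg_right (show x ≤ z / 10 by linarith) (show 0 ≤ z by linarith),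
      sq_nonneg (x - y), sq_nonneg x, sq_nonneg y]
  have hy1 : 1 < y := by linarith
  refine ⟨?_, hy1, by linarith⟩
  by_contra hc
  push Not at hc
  have : z < y * z := by nlinarith
  nlinarith

lemma order_aux3 {x y z C : ℝ} (hC : 0 < C) (hx : 0 < x) (hy : 0 < y) (hz : 0 < z)
    (hp : x * (y * z) ≤ C) (hs : 3 * C + 31 ≤ x + y + z)
    (hq : (3/4) * (x^2 + y^2 + z^2 - 2*(x*y + y*z + z*x)) ≤ 1) :
    (x < 1 ∧ 1 < y ∧ 1 < z) ∨ (y < 1 ∧ 1 < z ∧ 1 < x) ∨ (z < 1 ∧ 1 < x ∧ 1 < y) := by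
  rcases le_total x y with h1 | h1 <;> rcases le_total y z with h2 | h2 <;>
    rcases le_total x z with h3 | h3
  · have := order_aux (C := C) hC hx h1 h2 (by linarith) (by linarith) (by linarith); tauto
  · have := order_aux (C := C) hC hx h1 h2 (by linarith) (by linarith) (by linarith); tauto
  · have := order_aux (C := C) hC hx h3 h2 (by linarith) (by linarith) (by linarith); tauto
  · have := order_aux (C := C) hC hz h3 h1 (by linarith) (by linarith) (by linarith); tauto
  · have := order_aux (C := C) hC hy h1 h3 (by linarith) (by linarith) (by linarith); tauto
  · have := order_aux (C := C) hC hy h2 h3 (by linarith) (by linarith) (by linarith); tauto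
  · have := order_aux (C := C) hC hz h2 h1 (by linarith) (by linarith) (by linarith); tauto
  · have := order_aux (C := C) hC hz h2 h1 (by linarith) (by linarith) (by linarith); tauto

lemma side_of_one {T : ℝ} {f : ℝ → ℝ} (hf : ContinuousOn f (Set.Iic T))
    (h1 : ∀ t ∈ Set.Iic T, f t ≠ 1) :
    (f T < 1 → ∀ t ∈ Set.Iic T, f t < 1) ∧ (1 < f T → ∀ t ∈ Set.Iic T, 1 < f t) := by
  have hTT : T ∈ Set.Iic T := Set.self_mem_Iic
  constructor
  · intro hT t ht
    by_contra hc
    push Not at hc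
    obtain ⟨s, hs, hs1⟩ := isPreconnected_Iic.intermediate_value hTT ht hf ⟨hT.le, hc⟩
    exact h1 s hs hs1
  · intro hT t ht
    by_contra hc
    push Not at hc
    obtain ⟨s, hs, hs1⟩ := isPreconnected_Iic.intermediate_value ht hTT hf ⟨hc, hT.le⟩
    exact h1 s hs hs1

lemma SolOn.mono {γ : ℝ} {s s' : Set ℝ} {O Sp Sm n1 n2 n3 : ℝ → ℝ}
    (h : SolOn γ s O Sp Sm n1 n2 n3) (hs : s' ⊆ s) : SolOn γ s' O Sp Sm n1 n2 n3 :=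
  ⟨fun t ht => h.hn1 t (hs ht), fun t ht => h.hn2 t (hs ht), fun t ht => h.hn3 t (hs ht),
   fun t ht => h.hSp t (hs ht), fun t ht => h.hSm t (hs ht), fun t ht => h.hO t (hs ht),
   fun t ht => h.hOnn t (hs ht), fun t ht => h.hcon t (hs ht)⟩

lemma prod_tendsto {T : ℝ} {a b c : ℝ → ℝ} (ha : ∀ t ∈ Set.Iic T, a t < 1)
    (hb : ∀ t ∈ Set.Iic T, 1 < b t) (hc : ∀ t ∈ Set.Iic T, 1 < c t)
    (hS : Tendsto (fun t => a t + b t + c t) atBot atTop) :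
    Tendsto (fun t => b t * c t) atBot atTop := by
  refine tendsto_atTop_mono' _ ?_ (tendsto_atTop_add_const_right _ (-2) hS)
  filter_upwards [eventually_le_atBot T] with t ht
  nlinarith [ha t ht, hb t ht, hc t ht]

lemma not_tendsto (γ : ℝ) (hγ1 : 2/3 < γ) (O Sp Sm n1 n2 n3 : ℝ → ℝ)
    (hsol : SolOn γ (Set.Iic 0) O Sp Sm n1 n2 n3)
    (hIX : ∀ τ ∈ Set.Iic (0:ℝ), 0 < n1 τ ∧ 0 < n2 τ ∧ 0 < n3 τ)
    (hS : Tendsto (fun t => n1 t + n2 t + n3 t) atBot atTop) : False := by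
  set C := n1 0 * (n2 0 * n3 0) with hC
  have h00 : (0:ℝ) ∈ Set.Iic (0:ℝ) := Set.self_mem_Iic
  have hC0 : 0 < C := by
    obtain ⟨a, b, c⟩ := hIX 0 h00
    positivity
  have hmono := prod_mono hγ1 hsol hIX
  obtain ⟨T0, hT0⟩ := eventually_atBot.mp (hS.eventually_ge_atTop (3 * C + 31))
  set T := min T0 0 with hT
  have hsub : Set.Iic T ⊆ Set.Iic (0:ℝ) := Set.Iic_subset_Iic.mpr (min_le_right _ _)
  have hTT : T ∈ Set.Iic T := Set.self_mem_Iic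
  have hs := hsol.mono hsub
  have key : ∀ t ∈ Set.Iic T, (n1 t < 1 ∧ 1 < n2 t ∧ 1 < n3 t) ∨ (n2 t < 1 ∧ 1 < n3 t ∧ 1 < n1 t)
      ∨ (n3 t < 1 ∧ 1 < n1 t ∧ 1 < n2 t) := by
    intro t ht
    obtain ⟨a, b, c⟩ := hIX t (hsub ht)
    refine order_aux3 hC0 a b c (hmono (hsub ht) h00 (hsub ht))
      (hT0 t (le_trans ht (min_le_left _ _))) ?_
    have h1 := hs.hcon t ht
    have h2 := hs.hOnn t ht
    unfold Constraint at h1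
    nlinarith [sq_nonneg (Sp t), sq_nonneg (Sm t)]
  obtain ⟨l1, u1⟩ := side_of_one (T := T) (f := n1)
    (fun t ht => (hs.hn1 t ht).continuousAt.continuousWithinAt)
    (by intro t ht h; have := key t ht; rw [h] at this; simp at this)
  obtain ⟨l2, u2⟩ := side_of_one (T := T) (f := n2)
    (fun t ht => (hs.hn2 t ht).continuousAt.continuousWithinAt)
    (by intro t ht h; have := key t ht; rw [h] at this; simp at this)
  obtain ⟨l3, u3⟩ := side_of_one (T := T) (f := n3)
    (fun t ht => (hs.hn3 t ht).continuousAt.continuousWithinAt)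
    (by intro t ht h; have := key t ht; rw [h] at this; simp at this)
  rcases key T hTT with ⟨a, b, c⟩ | ⟨a, b, c⟩ | ⟨a, b, c⟩
  · exact main_false γ T hγ1 _ _ _ _ _ _ hs (fun t ht => (hIX t (hsub ht)).1) (l1 a) (u2 b) (u3 c)
      (prod_tendsto (l1 a) (u2 b) (u3 c) hS)
  · exact main_false γ T hγ1 _ _ _ _ _ _ hs.rot (fun t ht => (hIX t (hsub ht)).2.1)
      (l2 a) (u3 b) (u1 c)
      (prod_tendsto (l2 a) (u3 b) (u1 c) (hS.congr (fun t => by ring)))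
  · exact main_false γ T hγ1 _ _ _ _ _ _ hs.rot.rot (fun t ht => (hIX t (hsub ht)).2.2)
      (l3 a) (u1 b) (u2 c)
      (prod_tendsto (l3 a) (u1 b) (u2 c) (hS.congr (fun t => by ring)))

/-- every Bianchi IX solution with `2/3 < γ < 2` has a nonempty
α-limit set. -/
theorem bianchiIX_alpha_limit_point_exists
    (γ : ℝ) (hγ1 : 2/3 < γ) (hγ2 : γ < 2)
    (O Sp Sm n1 n2 n3 : ℝ → ℝ)
    (hsol : SolOn γ (Set.Iic 0) O Sp Sm n1 n2 n3)
    (hIX : ∀ τ ∈ Set.Iic (0:ℝ), 0 < n1 τ ∧ 0 < n2 τ ∧ 0 < n3 τ) :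
    ∃ a b c d e f : ℝ, AlphaLim O Sp Sm n1 n2 n3 a b c d e f := by
  by_cases hS : Tendsto (fun t => n1 t + n2 t + n3 t) atBot atTop
  · exact (not_tendsto γ hγ1 O Sp Sm n1 n2 n3 hsol hIX hS).elim
  rw [tendsto_atTop] at hS
  push Not at hS
  obtain ⟨B, hB⟩ := hS
  have hfr : ∃ᶠ t in atBot, (n1 t + n2 t + n3 t < B ∧ t ≤ 0) := by
    refine Frequently.and_eventually ?_ (eventually_le_atBot 0)
    simpa [Filter.Frequently] using hB
  obtain ⟨ts, hts, hts2⟩ := Filter.exists_seq_forall_of_frequently hfr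
  set M := 1 + 3 * B^2 + |B| with hM
  set F : ℕ → ℝ × ℝ × ℝ × ℝ × ℝ × ℝ := fun k =>
    (O (ts k), Sp (ts k), Sm (ts k), n1 (ts k), n2 (ts k), n3 (ts k)) with hF
  set I := Set.Icc (-M) M with hI
  have hcomp : IsCompact (I ×ˢ I ×ˢ I ×ˢ I ×ˢ I ×ˢ I) :=
    isCompact_Icc.prod (isCompact_Icc.prod (isCompact_Icc.prod (isCompact_Icc.prod
      (isCompact_Icc.prod isCompact_Icc))))
  have hmem : ∀ k, F k ∈ I ×ˢ I ×ˢ I ×ˢ I ×ˢ I ×ˢ I := by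
    intro k
    obtain ⟨hlt, hle⟩ := hts2 k
    have hO := hsol.hOnn (ts k) hle
    have hc := hsol.hcon (ts k) hle
    obtain ⟨p1, p2, p3⟩ := hIX (ts k) hle
    unfold Constraint at hc
    have hB0 : 0 < B := by linarith
    have habs : |B| = B := abs_of_pos hB0
    have hM1 : 1 + 3 * B^2 ≤ M := by rw [hM]; linarith [abs_nonneg B]
    have hM2 : B ≤ M := by rw [hM, habs]; nlinarith
    have hM3 : 1 ≤ M := by nlinarith
    have hsum : O (ts k) + Sp (ts k)^2 + Sm (ts k)^2 ≤ M := by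
      have a1 : n1 (ts k) * n2 (ts k) ≤ B * B :=
        mul_le_mul (by linarith) (by linarith) p2.le hB0.le
      have a2 : n2 (ts k) * n3 (ts k) ≤ B * B :=
        mul_le_mul (by linarith) (by linarith) p3.le hB0.le
      have a3 : n3 (ts k) * n1 (ts k) ≤ B * B :=
        mul_le_mul (by linarith) (by linarith) p1.le hB0.le
      nlinarith [sq_nonneg (n1 (ts k) - n2 (ts k)), sq_nonneg (n3 (ts k)),
        mul_pos (show 0 < n1 (ts k) + n2 (ts k) by linarith) p3,
        mul_pos p1 p2, mul_pos p2 p3, mul_pos p3 p1,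
        pow_le_pow_left₀ (by linarith) hlt.le 2, sq_nonneg (n1 (ts k)), sq_nonneg (n2 (ts k))]
    have hSp : |Sp (ts k)| ≤ M := by
      refine abs_le_of_sq_le_sq ?_ (by linarith)
      nlinarith [sq_nonneg (Sm (ts k))]
    have hSm : |Sm (ts k)| ≤ M := by
      refine abs_le_of_sq_le_sq ?_ (by linarith)
      nlinarith [sq_nonneg (Sp (ts k))]
    refine ⟨⟨by linarith, ?_⟩, abs_le.mp hSp, abs_le.mp hSm, ⟨?_, ?_⟩, ⟨?_, ?_⟩, ⟨?_, ?_⟩⟩ <;>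
      simp only [hF] <;> nlinarith [sq_nonneg (Sp (ts k)), sq_nonneg (Sm (ts k))]
  obtain ⟨⟨a, b, c, d, e, f⟩, -, φ, hφ, hlim⟩ := hcomp.tendsto_subseq hmem
  refine ⟨a, b, c, d, e, f, ts ∘ φ, hts.comp hφ.tendsto_atTop, ?_⟩
  simp only [Prod.tendsto_iff] at hlim
  exact hlim

end WainwrightHsu
end
end

section
/- Consider the Wainwright–Hsu system with 2/3 < γ ≤ 2. Every solution which is not of Bianchi type IX has maximal existence interval (−∞, ∞). Every Bianchi type IX solution exists globally to the past, i.e. its maximal existence interval is of the form (−∞, τ₊). -/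
open Real Filter Topology Set

noncomputable section

namespace WainwrightHsu

section AbstractODE

open Metric

variable {E : Type*} [NormedAddCommGroup E] [NormedSpace ℝ E] [FiniteDimensional ℝ E]

/-- Cut off a `C¹` vector field outside a ball. -/
lemma exists_cutoff {F : E → E} (hF : ContDiff ℝ 1 F) (M : ℝ) :
    ∃ (G : E → E) (K L : NNReal), LipschitzWith K G ∧ (∀ x, ‖G x‖ ≤ L) ∧
      ∀ x, ‖x‖ ≤ M → G x = F x := by
  let φ : ContDiffBump (0 : E) := ⟨|M| + 1, |M| + 2, by positivity, by linarith⟩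
  have hc : HasCompactSupport (fun x => φ x • F x) := φ.hasCompactSupport.smul_right
  have hd : ContDiff ℝ 1 (fun x => φ x • F x) := φ.contDiff.smul hF
  obtain ⟨K, hK⟩ := ContDiff.lipschitzWith_of_hasCompactSupport hc hd (by simp)
  obtain ⟨C, hC⟩ := hc.exists_bound_of_continuous hd.continuous
  refine ⟨_, K, C.toNNReal, hK, fun x => (hC x).trans (Real.le_coe_toNNReal C), fun x hx => ?_⟩
  have : φ x = 1 := by
    apply φ.one_of_mem_closedBall
    simp only [mem_closedBall, dist_zero_right]
    change ‖x‖ ≤ |M| + 1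
    linarith [le_abs_self M]
  simp [this]

/-- Uniqueness for `C¹` autonomous vector fields. -/
lemma ode_unique {F : E → E} (hF : ContDiff ℝ 1 F) {c d t0 : ℝ} (ht0 : t0 ∈ Ioo c d)
    {f g : ℝ → E} (hf : ∀ t ∈ Ioo c d, HasDerivAt f (F (f t)) t)
    (hg : ∀ t ∈ Ioo c d, HasDerivAt g (F (g t)) t) (h0 : f t0 = g t0) :
    ∀ t ∈ Ioo c d, f t = g t := by
  intro t ht
  obtain ⟨c', hc1, hc2⟩ := exists_between (lt_min ht0.1 ht.1)
  obtain ⟨d', hd1, hd2⟩ := exists_between (max_lt ht0.2 ht.2)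
  have hsub : Icc c' d' ⊆ Ioo c d := fun s hs => ⟨hc1.trans_le hs.1, hs.2.trans_lt hd2⟩
  obtain ⟨Mf, hMf⟩ := (isCompact_Icc (a := c') (b := d')).exists_bound_of_continuousOn
    (f := f) (fun s hs => (hf s (hsub hs)).continuousAt.continuousWithinAt)
  obtain ⟨Mg, hMg⟩ := (isCompact_Icc (a := c') (b := d')).exists_bound_of_continuousOn
    (f := g) (fun s hs => (hg s (hsub hs)).continuousAt.continuousWithinAt)
  obtain ⟨G, K, L, hK, -, hG⟩ := exists_cutoff hF (max Mf Mg)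
  have hs' : Ioo c' d' ⊆ Icc c' d' := Ioo_subset_Icc_self
  refine ODE_solution_unique_of_mem_Ioo (v := fun _ => G) (s := fun _ => univ) (K := K)
    (a := c') (b := d') (t₀ := t0)
    (fun _ _ => hK.lipschitzOnWith)
    ⟨(lt_min_iff.1 hc2).1, (max_lt_iff.1 hd1).1⟩ (fun s hs => ⟨?_, trivial⟩)
    (fun s hs => ⟨?_, trivial⟩) h0 ⟨(lt_min_iff.1 hc2).2, (max_lt_iff.1 hd1).2⟩
  · rw [hG _ ((hMf s (hs' hs)).trans (le_max_left _ _))]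
    exact hf s (hsub (hs' hs))
  · rw [hG _ ((hMg s (hs' hs)).trans (le_max_right _ _))]
    exact hg s (hsub (hs' hs))

/-- Existence on an interval from an a priori bound. -/
lemma ode_exists {F : E → E} (hF : ContDiff ℝ 1 F) {c d t0 : ℝ} (ht0 : t0 ∈ Ioo c d)
    (x0 : E) (R : ℝ)
    (hR : ∀ c' d', c ≤ c' → d' ≤ d → t0 ∈ Ioo c' d' → ∀ y : ℝ → E, y t0 = x0 →
      (∀ t ∈ Ioo c' d', HasDerivAt y (F (y t)) t) → ∀ t ∈ Ioo c' d', ‖y t‖ ≤ R) :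
    ∃ y : ℝ → E, y t0 = x0 ∧ ∀ t ∈ Ioo c d, HasDerivAt y (F (y t)) t := by
  obtain ⟨G, K, L, hK, hL, hG⟩ := exists_cutoff hF (max R ‖x0‖ + 1)
  set R' := max R ‖x0‖ with hR'
  have hpl : IsPicardLindelof (fun _ => G) (tmin := c) (tmax := d)
      ⟨t0, ht0.1.le, ht0.2.le⟩ x0 (L * (max (d - t0) (t0 - c)).toNNReal) 0 L K :=
    { lipschitzOnWith := fun _ _ => hK.lipschitzOnWith
      continuousOn := fun _ _ => continuousOn_const
      norm_le := fun _ _ x _ => hL x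
      mul_max_le := by
        have : 0 ≤ max (d - t0) (t0 - c) := le_max_of_le_left (by linarith [ht0.2])
        simp [Real.coe_toNNReal _ this] }
  obtain ⟨z, hz0, hz⟩ := hpl.exists_eq_forall_mem_Icc_hasDerivWithinAt₀
  simp only at hz0
  have hz' : ∀ t ∈ Ioo c d, HasDerivAt z (G (z t)) t := fun t ht =>
    (hz t (Ioo_subset_Icc_self ht)).hasDerivAt (Icc_mem_nhds ht.1 ht.2)
  have hcont : ∀ t ∈ Ioo c d, ContinuousAt z t := fun t ht => (hz' t ht).continuousAt
  let A : Set ℝ := {t | ∃ c' d', c ≤ c' ∧ d' ≤ d ∧ t0 ∈ Ioo c' d' ∧ t ∈ Ioo c' d' ∧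
    ∀ s ∈ Ioo c' d', ‖z s‖ < R' + 1}
  have hloc : ∀ t ∈ Ioo c d, ‖z t‖ ≤ R' → ∃ c' d', c ≤ c' ∧ d' ≤ d ∧ t ∈ Ioo c' d' ∧
      ∀ s ∈ Ioo c' d', ‖z s‖ < R' + 1 := by
    intro t ht hzt
    have h1 : ∀ᶠ s in 𝓝 t, ‖z s‖ < R' + 1 :=
      (hcont t ht).norm.eventually_lt continuousAt_const (by linarith)
    obtain ⟨ε, hε, h2⟩ := Metric.eventually_nhds_iff.1 h1
    refine ⟨max c (t - ε), min d (t + ε), le_max_left _ _, min_le_left _ _,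
      ⟨max_lt ht.1 (by linarith), lt_min ht.2 (by linarith)⟩, fun s hs => h2 ?_⟩
    rw [Real.dist_eq, abs_lt]
    have := (max_lt_iff.1 hs.1).2
    have := (lt_min_iff.1 hs.2).2
    constructor <;> linarith
  have hAbd : ∀ t ∈ A, ‖z t‖ ≤ R' := by
    rintro t ⟨c', d', h1, h2, h3, h4, h5⟩
    refine (hR c' d' h1 h2 h3 z hz0 (fun s hs => ?_) t h4).trans (le_max_left _ _)
    rw [← hG _ (h5 s hs).le]
    exact hz' s ⟨h1.trans_lt hs.1, hs.2.trans_le h2⟩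
  have hAo : IsOpen A := by
    rw [isOpen_iff_mem_nhds]
    rintro t ⟨c', d', h1, h2, h3, h4, h5⟩
    filter_upwards [Ioo_mem_nhds h4.1 h4.2] with s hs
    exact ⟨c', d', h1, h2, h3, hs, h5⟩
  have hsub : Ioo c d ⊆ A := by
    refine isPreconnected_Ioo.subset_of_closure_inter_subset hAo ?_ ?_
    · obtain ⟨c', d', h1, h2, h3, h4⟩ := hloc t0 ht0 (by rw [hz0]; exact le_max_right _ _)
      exact ⟨t0, ht0, c', d', h1, h2, h3, h3, h4⟩
    · rintro t ⟨htA, ht⟩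
      have hzt : ‖z t‖ ≤ R' := by
        have hfr : ∃ᶠ s in 𝓝 t, s ∈ A := mem_closure_iff_frequently.1 htA
        by_contra hlt
        push Not at hlt
        have h1 : ∀ᶠ s in 𝓝 t, R' < ‖z s‖ :=
          continuousAt_const.eventually_lt (hcont t ht).norm hlt
        obtain ⟨s, hs1, hs2⟩ := (hfr.and_eventually h1).exists
        exact absurd (hAbd s hs1) (not_le.2 hs2)
      obtain ⟨c1, d1, h1, h2, h3, h4⟩ := hloc t ht hzt
      obtain ⟨s, hs, c2, d2, g1, g2, g3, g4, g5⟩ :=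
        mem_closure_iff.1 htA _ isOpen_Ioo h3
      refine ⟨min c1 c2, max d1 d2, le_min h1 g1, max_le h2 g2,
        ⟨min_lt_of_right_lt g3.1, lt_max_of_lt_right g3.2⟩,
        ⟨min_lt_of_left_lt h3.1, lt_max_of_lt_left h3.2⟩, fun r hr => ?_⟩
      by_cases hr1 : r ∈ Ioo c1 d1
      · exact h4 r hr1
      · refine g5 r ?_
        have a1 := min_lt_iff.1 hr.1
        have a2 := lt_max_iff.1 hr.2
        simp only [mem_Ioo, not_and_or, not_lt] at hr1
        have := hs.1; have := hs.2; have := g4.1; have := g4.2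
        constructor
        · rcases a1 with a1 | a1
          · rcases hr1 with b | b <;> linarith
          · exact a1
        · rcases a2 with a2 | a2
          · rcases hr1 with b | b <;> linarith
          · exact a2
  refine ⟨z, hz0, fun t ht => ?_⟩
  rw [← hG _ (by linarith [hAbd t (hsub ht)])]
  exact hz' t ht

/-- Existence on an open interval `I` from a priori bounds on compact subintervals. -/
lemma ode_exists_glue {F : E → E} (hF : ContDiff ℝ 1 F) {I : Set ℝ} (hI : IsOpen I)
    {t0 : ℝ} (ht0 : t0 ∈ I) (x0 : E)
    (hR : ∀ c d, c ∈ I → d ∈ I → t0 ∈ Ioo c d → ∃ R : ℝ,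
      ∀ c' d', c ≤ c' → d' ≤ d → t0 ∈ Ioo c' d' → ∀ y : ℝ → E, y t0 = x0 →
      (∀ t ∈ Ioo c' d', HasDerivAt y (F (y t)) t) → ∀ t ∈ Ioo c' d', ‖y t‖ ≤ R) :
    ∃ y : ℝ → E, y t0 = x0 ∧ ∀ t ∈ I, HasDerivAt y (F (y t)) t := by
  have hnb : ∀ t ∈ I, ∃ c ∈ I, ∃ d ∈ I, c < t ∧ t < d := by
    intro t ht
    obtain ⟨ε, hε, h⟩ := Metric.isOpen_iff.1 hI t ht
    refine ⟨t - ε / 2, h ?_, t + ε / 2, h ?_, by linarith, by linarith⟩ <;>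
    · rw [mem_ball, Real.dist_eq, abs_lt]; constructor <;> linarith
  have hex : ∀ t, ∃ c d, ∃ y : ℝ → E, t ∈ I → (t0 ∈ Ioo c d ∧ t ∈ Ioo c d ∧ y t0 = x0 ∧
      ∀ t ∈ Ioo c d, HasDerivAt y (F (y t)) t) := by
    intro t
    by_cases ht : t ∈ I
    · obtain ⟨c1, hc1, d1, hd1, h1, h2⟩ := hnb t0 ht0
      obtain ⟨c2, hc2, d2, hd2, h3, h4⟩ := hnb t ht
      have hc : min c1 c2 ∈ I := by rcases min_choice c1 c2 with h | h <;> rw [h] <;> assumption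
      have hd : max d1 d2 ∈ I := by rcases max_choice d1 d2 with h | h <;> rw [h] <;> assumption
      have h0 : t0 ∈ Ioo (min c1 c2) (max d1 d2) :=
        ⟨min_lt_of_left_lt h1, lt_max_of_lt_left h2⟩
      obtain ⟨R, h⟩ := hR _ _ hc hd h0
      obtain ⟨y, hy⟩ := ode_exists hF h0 x0 R h
      exact ⟨_, _, y, fun _ => ⟨h0, ⟨min_lt_of_right_lt h3, lt_max_of_lt_right h4⟩, hy⟩⟩
    · exact ⟨0, 0, 0, fun h => absurd h ht⟩
  choose c d y hy using hex
  have key : ∀ t ∈ I, ∀ s ∈ I, s ∈ Ioo (c t) (d t) → y s s = y t s := by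
    intro t ht s hs hst
    obtain ⟨a1, a2, a3, a4⟩ := hy t ht
    obtain ⟨b1, b2, b3, b4⟩ := hy s hs
    refine ode_unique hF (c := max (c t) (c s)) (d := min (d t) (d s)) (t0 := t0)
      ⟨max_lt a1.1 b1.1, lt_min a1.2 b1.2⟩ (fun r hr => b4 r ?_) (fun r hr => a4 r ?_)
      (b3.trans a3.symm) s ⟨max_lt hst.1 b2.1, lt_min hst.2 b2.2⟩
    · exact ⟨(max_lt_iff.1 hr.1).2, (lt_min_iff.1 hr.2).2⟩
    · exact ⟨(max_lt_iff.1 hr.1).1, (lt_min_iff.1 hr.2).1⟩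
  refine ⟨fun t => y t t, (hy t0 ht0).2.2.1, fun t ht => ?_⟩
  obtain ⟨a1, a2, a3, a4⟩ := hy t ht
  refine (a4 t a2).congr_of_eventuallyEq ?_
  filter_upwards [hI.mem_nhds ht, Ioo_mem_nhds a2.1 a2.2] with s hs hst
  exact key t ht s hs hst

end AbstractODE

/-- Scalar linear equation `u' = g u`. -/
lemma lin_sol {u g : ℝ → ℝ} {c d t0 : ℝ} (ht0 : t0 ∈ Ioo c d)
    (hu : ∀ t ∈ Ioo c d, HasDerivAt u (g t * u t) t) (hg : ContinuousOn g (Ioo c d))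
    {t : ℝ} (ht : t ∈ Ioo c d) :
    ∃ k : ℝ, 0 < k ∧ u t = k * u t0 ∧
      ∀ G : ℝ, (∀ s ∈ uIcc t0 t, |g s| ≤ G) → k ≤ Real.exp (G * |t - t0|) := by
  have hint : ∀ s ∈ Ioo c d, IntervalIntegrable g MeasureTheory.volume t0 s := fun s hs =>
    (hg.mono (ordConnected_Ioo.uIcc_subset ht0 hs)).intervalIntegrable
  have hA : ∀ s ∈ Ioo c d, HasDerivAt (fun r => ∫ x in t0..r, g x) (g s) s := fun s hs =>
    intervalIntegral.integral_hasDerivAt_right (hint s hs)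
      (hg.stronglyMeasurableAtFilter isOpen_Ioo s hs)
      (hg.continuousAt (isOpen_Ioo.mem_nhds hs))
  set A : ℝ → ℝ := fun r => ∫ x in t0..r, g x with hAdef
  have hv : ∀ s ∈ Ioo c d, HasDerivAt (fun r => u r * Real.exp (-A r)) 0 s := fun s hs => by
    have := (hu s hs).mul ((hA s hs).neg.exp)
    refine this.congr_deriv ?_
    ring
  have hc := isOpen_Ioo.is_const_of_deriv_eq_zero isPreconnected_Ioo
    (fun s hs => (hv s hs).differentiableAt.differentiableWithinAt)
    (fun s hs => (hv s hs).deriv) ht ht0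
  have hA0 : A t0 = 0 := by simp [hAdef]
  refine ⟨Real.exp (A t), Real.exp_pos _, ?_, fun G hG => ?_⟩
  · simp only [hA0, neg_zero, Real.exp_zero, mul_one] at hc
    rw [← hc, mul_comm (u t), ← mul_assoc, ← Real.exp_add]
    simp
  · apply Real.exp_le_exp.2
    refine (le_abs_self _).trans ?_
    exact intervalIntegral.norm_integral_le_of_norm_le_const (f := g) (C := G)
      (fun x hx => hG x (uIoc_subset_uIcc hx))

/-- The vector field of the system on `ℝ⁶`, coordinates `Ω, Σ₊, Σ₋, N₁, N₂, N₃`. -/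
def vf (γ : ℝ) (y : Fin 6 → ℝ) : Fin 6 → ℝ :=
  ![(2 * qf γ (y 0) (y 1) (y 2) - (3*γ - 2)) * y 0,
    -(2 - qf γ (y 0) (y 1) (y 2)) * y 1 - 3 * SPf (y 3) (y 4) (y 5),
    -(2 - qf γ (y 0) (y 1) (y 2)) * y 2 - 3 * SMf (y 3) (y 4) (y 5),
    (qf γ (y 0) (y 1) (y 2) - 4 * y 1) * y 3,
    (qf γ (y 0) (y 1) (y 2) + 2 * y 1 + 2 * Real.sqrt 3 * y 2) * y 4,
    (qf γ (y 0) (y 1) (y 2) + 2 * y 1 - 2 * Real.sqrt 3 * y 2) * y 5]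

lemma contDiff_vf (γ : ℝ) : ContDiff ℝ 1 (vf γ) := by
  rw [contDiff_pi]
  intro i
  fin_cases i <;> simp [vf, qf, SPf, SMf] <;> fun_prop

/-- The solution as a curve in `ℝ⁶`. -/
def vec (O Sp Sm n1 n2 n3 : ℝ → ℝ) (t : ℝ) : Fin 6 → ℝ :=
  ![O t, Sp t, Sm t, n1 t, n2 t, n3 t]

lemma SolOn.vec_deriv {γ : ℝ} {s : Set ℝ} {O Sp Sm n1 n2 n3 : ℝ → ℝ}
    (h : SolOn γ s O Sp Sm n1 n2 n3) {t : ℝ} (ht : t ∈ s) :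
    HasDerivAt (vec O Sp Sm n1 n2 n3) (vf γ (vec O Sp Sm n1 n2 n3 t)) t := by
  rw [hasDerivAt_pi]
  intro i
  fin_cases i
  · exact h.hO t ht
  · exact h.hSp t ht
  · exact h.hSm t ht
  · exact h.hn1 t ht
  · exact h.hn2 t ht
  · exact h.hn3 t ht

lemma SolOn.of_vec {γ : ℝ} {c d t0 : ℝ} (ht0 : t0 ∈ Ioo c d) {y : ℝ → Fin 6 → ℝ}
    (h : ∀ t ∈ Ioo c d, HasDerivAt y (vf γ (y t)) t) (hO : 0 ≤ y t0 0)
    (hC : Constraint (y t0 0) (y t0 1) (y t0 2) (y t0 3) (y t0 4) (y t0 5)) :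
    SolOn γ (Ioo c d) (fun t => y t 0) (fun t => y t 1) (fun t => y t 2)
      (fun t => y t 3) (fun t => y t 4) (fun t => y t 5) := by
  have hp := fun t ht => hasDerivAt_pi.1 (h t ht)
  have d0 := fun t ht => hp t ht 0
  have d1 := fun t ht => hp t ht 1
  have d2 := fun t ht => hp t ht 2
  have d3 := fun t ht => hp t ht 3
  have d4 := fun t ht => hp t ht 4
  have d5 := fun t ht => hp t ht 5
  simp only [vf, Matrix.cons_val] at d0 d1 d2 d3 d4 d5
  have c0 : ContinuousOn (fun t => y t 0) (Ioo c d) := HasDerivAt.continuousOn d0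
  have c1 : ContinuousOn (fun t => y t 1) (Ioo c d) := HasDerivAt.continuousOn d1
  have c2 : ContinuousOn (fun t => y t 2) (Ioo c d) := HasDerivAt.continuousOn d2
  have cq : ContinuousOn (fun t => qf γ (y t 0) (y t 1) (y t 2)) (Ioo c d) := by
    unfold qf; fun_prop
  refine ⟨d3, d4, d5, d1, d2, d0, fun t ht => ?_, fun t ht => ?_⟩
  · obtain ⟨k, hk, he, -⟩ := lin_sol ht0 d0 (by fun_prop) ht
    rw [he]; positivity
  · obtain ⟨k, hk, he, -⟩ := lin_sol ht0
      (u := fun t => y t 0 + y t 1 ^ 2 + y t 2 ^ 2 + (3/4) * (y t 3 ^ 2 + y t 4 ^ 2 + y t 5 ^ 2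
        - 2 * (y t 3 * y t 4 + y t 4 * y t 5 + y t 5 * y t 3)) - 1)
      (g := fun t => 2 * qf γ (y t 0) (y t 1) (y t 2)) (fun t ht => by
        have := (((d0 t ht).add ((d1 t ht).pow 2)).add ((d2 t ht).pow 2)).add
          ((((((d3 t ht).pow 2).add ((d4 t ht).pow 2)).add ((d5 t ht).pow 2)).sub
            (((((d3 t ht).mul (d4 t ht)).add ((d4 t ht).mul (d5 t ht))).add
              ((d5 t ht).mul (d3 t ht))).const_mul 2)).const_mul (3/4)) |>.sub_const 1
        refine this.congr_deriv ?_
        have h3 : Real.sqrt 3 ^ 2 = 3 := Real.sq_sqrt (by norm_num)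
        simp only [qf, SPf, SMf]
        push_cast
        ring_nf) (by fun_prop) ht
    unfold Constraint at hC ⊢
    simp only [hC, sub_self, mul_zero] at he
    linarith

/-- Not of type IX: the curvature term is non-negative. -/
lemma curv_nonneg {x y z : ℝ}
    (h : ¬ ((0 < x ∧ 0 < y ∧ 0 < z) ∨ (x < 0 ∧ y < 0 ∧ z < 0))) :
    0 ≤ x^2 + y^2 + z^2 - 2*(x*y + y*z + z*x) := by
  rcases lt_trichotomy x 0 with hx | hx | hx <;> rcases lt_trichotomy y 0 with hy | hy | hy <;>
  rcases lt_trichotomy z 0 with hz | hz | hz <;> first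
    | (exfalso; apply h; left; refine ⟨?_, ?_, ?_⟩ <;> assumption)
    | (exfalso; apply h; right; refine ⟨?_, ?_, ?_⟩ <;> assumption)
    | (subst hx; nlinarith [sq_nonneg (y - z)])
    | (subst hy; nlinarith [sq_nonneg (x - z)])
    | (subst hz; nlinarith [sq_nonneg (x - y)])
    | nlinarith [sq_nonneg (y - z), mul_neg_of_neg_of_pos hx hy, mul_neg_of_neg_of_pos hx hz]
    | nlinarith [sq_nonneg (x - z), mul_neg_of_neg_of_pos hx hy, mul_neg_of_neg_of_pos hz hy]
    | nlinarith [sq_nonneg (x - y), mul_neg_of_neg_of_pos hx hz, mul_neg_of_neg_of_pos hy hz]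
    | nlinarith [sq_nonneg (x - y), mul_neg_of_neg_of_pos hz hx, mul_neg_of_neg_of_pos hz hy]
    | nlinarith [sq_nonneg (x - z), mul_neg_of_neg_of_pos hy hx, mul_neg_of_neg_of_pos hy hz]
    | nlinarith [sq_nonneg (z - y), mul_neg_of_neg_of_pos hy hx, mul_neg_of_neg_of_pos hz hx]

lemma curv_lower_pos {x y z : ℝ} (hx : 0 < x) (hy : 0 < y) (hz : 0 < z) :
    -(4 * (x * y * z) + 6) ≤ x^2 + y^2 + z^2 - 2*(x*y + y*z + z*x) := by
  have hxy := mul_pos hx hy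
  have hyz := mul_pos hy hz
  have hzx := mul_pos hz hx
  by_cases h1 : 1 ≤ x
  · nlinarith [sq_nonneg (x - y - z), mul_nonneg (sub_nonneg.2 h1) hyz.le]
  by_cases h2 : 1 ≤ y
  · nlinarith [sq_nonneg (y - x - z), mul_nonneg (sub_nonneg.2 h2) hzx.le]
  by_cases h3 : 1 ≤ z
  · nlinarith [sq_nonneg (z - y - x), mul_nonneg (sub_nonneg.2 h3) hxy.le]
  push Not at h1 h2 h3
  have : x * y < 1 := by nlinarith
  have : y * z < 1 := by nlinarith
  have : z * x < 1 := by nlinarith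
  nlinarith [sq_nonneg x, sq_nonneg y, sq_nonneg z, mul_pos hxy hz]

lemma curv_lower {x y z : ℝ}
    (h : (0 < x ∧ 0 < y ∧ 0 < z) ∨ (x < 0 ∧ y < 0 ∧ z < 0)) :
    -(4 * |x * y * z| + 6) ≤ x^2 + y^2 + z^2 - 2*(x*y + y*z + z*x) := by
  rcases h with ⟨hx, hy, hz⟩ | ⟨hx, hy, hz⟩
  · have := curv_lower_pos hx hy hz
    have := le_abs_self (x * y * z)
    linarith
  · have := curv_lower_pos (neg_pos.2 hx) (neg_pos.2 hy) (neg_pos.2 hz)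
    have := neg_le_abs (x * y * z)
    nlinarith

lemma SolOn.cont_q {γ : ℝ} {s : Set ℝ} {O Sp Sm n1 n2 n3 : ℝ → ℝ}
    (h : SolOn γ s O Sp Sm n1 n2 n3) :
    ContinuousOn Sp s ∧ ContinuousOn Sm s ∧
      ContinuousOn (fun t => qf γ (O t) (Sp t) (Sm t)) s := by
  have c0 : ContinuousOn O s := HasDerivAt.continuousOn h.hO
  have c1 : ContinuousOn Sp s := HasDerivAt.continuousOn h.hSp
  have c2 : ContinuousOn Sm s := HasDerivAt.continuousOn h.hSm
  refine ⟨c1, c2, ?_⟩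
  unfold qf; fun_prop

lemma coef_bounds {γ : ℝ} (hγ1 : 2/3 < γ) (hγ2 : γ ≤ 2) {o p m B : ℝ} (hB : 1 ≤ B)
    (ho : 0 ≤ o) (h : o + p^2 + m^2 ≤ B) :
    |o| ≤ B ∧ |p| ≤ B ∧ |m| ≤ B ∧ 0 ≤ qf γ o p m ∧ |qf γ o p m - 4 * p| ≤ 8 * B ∧
    |qf γ o p m + 2 * p + 2 * Real.sqrt 3 * m| ≤ 8 * B ∧
    |qf γ o p m + 2 * p - 2 * Real.sqrt 3 * m| ≤ 8 * B := by
  have h1 : |o| ≤ B := by rw [abs_of_nonneg ho]; nlinarith [sq_nonneg p, sq_nonneg m]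
  have h2 : |p| ≤ B := abs_le_of_sq_le_sq (by nlinarith [sq_nonneg m]) (by linarith)
  have h3 : |m| ≤ B := abs_le_of_sq_le_sq (by nlinarith [sq_nonneg p]) (by linarith)
  have h4 : 0 ≤ qf γ o p m := by
    unfold qf
    have : 0 ≤ (3 * γ - 2) * o := mul_nonneg (by linarith) ho
    nlinarith [sq_nonneg p, sq_nonneg m]
  have h5 : qf γ o p m ≤ 2 * B := by
    unfold qf
    have : (3 * γ - 2) * o ≤ 4 * o := mul_le_mul_of_nonneg_right (by linarith) ho
    nlinarith [sq_nonneg p, sq_nonneg m]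
  have hs0 : 0 ≤ Real.sqrt 3 := Real.sqrt_nonneg 3
  have hs2 : Real.sqrt 3 ≤ 2 := by
    rw [Real.sqrt_le_left (by norm_num)]; norm_num
  have h6 : |Real.sqrt 3 * m| ≤ 2 * B := by
    rw [abs_mul, abs_of_nonneg hs0]
    exact mul_le_mul hs2 h3 (abs_nonneg _) (by norm_num)
  have h2' := abs_le.1 h2
  have h6' := abs_le.1 h6
  refine ⟨h1, h2, h3, h4, ?_, ?_, ?_⟩ <;> rw [abs_le] <;> constructor <;> linarith [h2'.1, h2'.2, h6'.1, h6'.2]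

/-- Bounds of a solution at time `t` in terms of bounds on `Ω + Σ²`. -/
lemma SolOn.bound {γ : ℝ} (hγ1 : 2/3 < γ) (hγ2 : γ ≤ 2) {c d t0 : ℝ} (ht0 : t0 ∈ Ioo c d)
    {O Sp Sm n1 n2 n3 : ℝ → ℝ} (h : SolOn γ (Ioo c d) O Sp Sm n1 n2 n3) {t : ℝ}
    (ht : t ∈ Ioo c d) {B D : ℝ} (hB : 1 ≤ B) (hD : |t - t0| ≤ D)
    (hb : ∀ s ∈ uIcc t0 t, O s + Sp s ^ 2 + Sm s ^ 2 ≤ B) :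
    ‖vec O Sp Sm n1 n2 n3 t‖ ≤
      B + (|n1 t0| + |n2 t0| + |n3 t0|) * Real.exp (8 * B * D) := by
  obtain ⟨c1, c2, cq⟩ := h.cont_q
  have hsub : uIcc t0 t ⊆ Ioo c d := ordConnected_Ioo.uIcc_subset ht0 ht
  have hco := fun s (hs : s ∈ uIcc t0 t) =>
    coef_bounds hγ1 hγ2 hB (h.hOnn s (hsub hs)) (hb s hs)
  obtain ⟨k1, hk1, e1, b1⟩ := lin_sol ht0 h.hn1 (by fun_prop) ht
  obtain ⟨k2, hk2, e2, b2⟩ := lin_sol ht0 h.hn2 (by fun_prop) ht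
  obtain ⟨k3, hk3, e3, b3⟩ := lin_sol ht0 h.hn3 (by fun_prop) ht
  have hexp : Real.exp (8 * B * |t - t0|) ≤ Real.exp (8 * B * D) :=
    Real.exp_le_exp.2 (mul_le_mul_of_nonneg_left hD (by linarith))
  have b1' := (b1 (8 * B) (fun s hs => (hco s hs).2.2.2.2.1)).trans hexp
  have b2' := (b2 (8 * B) (fun s hs => (hco s hs).2.2.2.2.2.1)).trans hexp
  have b3' := (b3 (8 * B) (fun s hs => (hco s hs).2.2.2.2.2.2)).trans hexp
  obtain ⟨a0, a1, a2, -⟩ := hco t right_mem_uIcc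
  have f1 : |n1 t| ≤ |n1 t0| * Real.exp (8 * B * D) := by
    rw [e1, abs_mul, abs_of_pos hk1, mul_comm]
    exact mul_le_mul_of_nonneg_left b1' (abs_nonneg _)
  have f2 : |n2 t| ≤ |n2 t0| * Real.exp (8 * B * D) := by
    rw [e2, abs_mul, abs_of_pos hk2, mul_comm]
    exact mul_le_mul_of_nonneg_left b2' (abs_nonneg _)
  have f3 : |n3 t| ≤ |n3 t0| * Real.exp (8 * B * D) := by
    rw [e3, abs_mul, abs_of_pos hk3, mul_comm]
    exact mul_le_mul_of_nonneg_left b3' (abs_nonneg _)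
  have g1 : 0 ≤ |n1 t0| * Real.exp (8 * B * D) := by positivity
  have g2 : 0 ≤ |n2 t0| * Real.exp (8 * B * D) := by positivity
  have g3 : 0 ≤ |n3 t0| * Real.exp (8 * B * D) := by positivity
  rw [pi_norm_le_iff_of_nonneg (by linarith)]
  intro i
  fin_cases i <;> simp only [vec, Real.norm_eq_abs] <;> simp <;> linarith

/-- The signs of the `Nᵢ` are preserved. -/
lemma SolOn.type_iff {γ : ℝ} {c d t0 : ℝ} (ht0 : t0 ∈ Ioo c d)
    {O Sp Sm n1 n2 n3 : ℝ → ℝ} (h : SolOn γ (Ioo c d) O Sp Sm n1 n2 n3) {t : ℝ}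
    (ht : t ∈ Ioo c d) :
    ((0 < n1 t ∧ 0 < n2 t ∧ 0 < n3 t) ∨ (n1 t < 0 ∧ n2 t < 0 ∧ n3 t < 0)) ↔
    ((0 < n1 t0 ∧ 0 < n2 t0 ∧ 0 < n3 t0) ∨ (n1 t0 < 0 ∧ n2 t0 < 0 ∧ n3 t0 < 0)) := by
  obtain ⟨c1, c2, cq⟩ := h.cont_q
  obtain ⟨k1, hk1, e1, -⟩ := lin_sol ht0 h.hn1 (by fun_prop) ht
  obtain ⟨k2, hk2, e2, -⟩ := lin_sol ht0 h.hn2 (by fun_prop) ht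
  obtain ⟨k3, hk3, e3, -⟩ := lin_sol ht0 h.hn3 (by fun_prop) ht
  have hm : ∀ {k : ℝ}, 0 < k → ∀ {x : ℝ}, k * x < 0 ↔ x < 0 := fun hk x =>
    ⟨fun h => by by_contra hx; push Not at hx; nlinarith, mul_neg_of_pos_of_neg hk⟩
  rw [e1, e2, e3]
  simp only [mul_pos_iff_of_pos_left hk1, mul_pos_iff_of_pos_left hk2,
    mul_pos_iff_of_pos_left hk3, hm hk1, hm hk2,
    hm hk3]

/-- `|N₁N₂N₃|` is bounded to the past by its present value. -/
lemma SolOn.prod_le {γ : ℝ} (hγ1 : 2/3 < γ) (hγ2 : γ ≤ 2) {c d t0 : ℝ} (ht0 : t0 ∈ Ioo c d)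
    {O Sp Sm n1 n2 n3 : ℝ → ℝ} (h : SolOn γ (Ioo c d) O Sp Sm n1 n2 n3) {t : ℝ}
    (ht : t ∈ Ioo c d) (htt : t ≤ t0) :
    |n1 t * n2 t * n3 t| ≤ |n1 t0 * n2 t0 * n3 t0| := by
  have hq : ∀ s ∈ Ioo c d, 0 ≤ qf γ (O s) (Sp s) (Sm s) := fun s hs =>
    (coef_bounds hγ1 hγ2 (B := max 1 (O s + Sp s ^ 2 + Sm s ^ 2)) (le_max_left _ _)
      (h.hOnn s hs) (le_max_right _ _)).2.2.2.1
  have hd : ∀ s ∈ Ioo c d, HasDerivAt (fun s => (n1 s * n2 s * n3 s) ^ 2)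
      (6 * qf γ (O s) (Sp s) (Sm s) * (n1 s * n2 s * n3 s) ^ 2) s := fun s hs => by
    refine ((((h.hn1 s hs).mul (h.hn2 s hs)).mul (h.hn3 s hs)).pow 2).congr_deriv ?_
    simp only [Pi.mul_apply]
    push_cast
    ring
  have hm : MonotoneOn (fun s => (n1 s * n2 s * n3 s) ^ 2) (Ioo c d) := by
    refine monotoneOn_of_deriv_nonneg (convex_Ioo c d) (HasDerivAt.continuousOn hd)
      (fun s hs => ?_) (fun s hs => ?_)
    · rw [interior_Ioo] at hs
      exact (hd s hs).differentiableAt.differentiableWithinAt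
    · rw [interior_Ioo] at hs
      rw [(hd s hs).deriv]
      have := hq s hs
      positivity
  exact sq_le_sq.1 (hm ht ht0 htt)

/-- Extension of a solution from a priori bounds. -/
lemma SolOn.extend {γ : ℝ} {a b t0 : ℝ} (ht0 : t0 ∈ Ioo a b)
    {O Sp Sm n1 n2 n3 : ℝ → ℝ} (h : SolOn γ (Ioo a b) O Sp Sm n1 n2 n3)
    {I : Set ℝ} (hI : IsOpen I) (hIc : I.OrdConnected) (hab : Ioo a b ⊆ I)
    (hR : ∀ c d, c ∈ I → d ∈ I → t0 ∈ Ioo c d → ∃ R : ℝ,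
      ∀ c' d', c ≤ c' → d' ≤ d → t0 ∈ Ioo c' d' → ∀ P Tp Tm m1 m2 m3 : ℝ → ℝ,
      SolOn γ (Ioo c' d') P Tp Tm m1 m2 m3 →
      vec P Tp Tm m1 m2 m3 t0 = vec O Sp Sm n1 n2 n3 t0 →
      ∀ t ∈ Ioo c' d', ‖vec P Tp Tm m1 m2 m3 t‖ ≤ R) :
    ∃ O' Sp' Sm' n1' n2' n3' : ℝ → ℝ,
        SolOn γ I O' Sp' Sm' n1' n2' n3' ∧
        ∀ τ ∈ Set.Ioo a b, O' τ = O τ ∧ Sp' τ = Sp τ ∧ Sm' τ = Sm τ ∧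
          n1' τ = n1 τ ∧ n2' τ = n2 τ ∧ n3' τ = n3 τ := by
  have hO0 : 0 ≤ vec O Sp Sm n1 n2 n3 t0 0 := h.hOnn t0 ht0
  have hC0 : Constraint (vec O Sp Sm n1 n2 n3 t0 0) (vec O Sp Sm n1 n2 n3 t0 1)
    (vec O Sp Sm n1 n2 n3 t0 2) (vec O Sp Sm n1 n2 n3 t0 3) (vec O Sp Sm n1 n2 n3 t0 4)
    (vec O Sp Sm n1 n2 n3 t0 5) := h.hcon t0 ht0
  have hvec : ∀ (y : ℝ → Fin 6 → ℝ), vec (fun t => y t 0) (fun t => y t 1) (fun t => y t 2)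
      (fun t => y t 3) (fun t => y t 4) (fun t => y t 5) = y := by
    intro y; funext t i; fin_cases i <;> rfl
  obtain ⟨y, hy0, hy⟩ := ode_exists_glue (contDiff_vf γ) hI (hab ht0)
    (vec O Sp Sm n1 n2 n3 t0) (fun c d hc hd hcd => by
      obtain ⟨R, hR'⟩ := hR c d hc hd hcd
      refine ⟨R, fun c' d' h1 h2 h3 y hy0 hy => ?_⟩
      have := hR' c' d' h1 h2 h3 _ _ _ _ _ _
        (SolOn.of_vec h3 hy (by rw [hy0]; exact hO0) (by rw [hy0]; exact hC0))
      rw [hvec] at this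
      exact this hy0)
  have hloc : ∀ t ∈ I, SolOn γ {t} (fun t => y t 0) (fun t => y t 1) (fun t => y t 2)
      (fun t => y t 3) (fun t => y t 4) (fun t => y t 5) := by
    intro t ht
    have hnb : ∀ t ∈ I, ∃ c ∈ I, ∃ d ∈ I, c < t ∧ t < d := by
      intro t ht
      obtain ⟨ε, hε, h⟩ := Metric.isOpen_iff.1 hI t ht
      refine ⟨t - ε / 2, h ?_, t + ε / 2, h ?_, by linarith, by linarith⟩ <;>
      · rw [Metric.mem_ball, Real.dist_eq, abs_lt]; constructor <;> linarith
    obtain ⟨c1, hc1, d1, hd1, h1, h2⟩ := hnb t0 (hab ht0)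
    obtain ⟨c2, hc2, d2, hd2, h3, h4⟩ := hnb t ht
    have hc : min c1 c2 ∈ I := by rcases min_choice c1 c2 with h | h <;> rw [h] <;> assumption
    have hd : max d1 d2 ∈ I := by rcases max_choice d1 d2 with h | h <;> rw [h] <;> assumption
    have hs := SolOn.of_vec (γ := γ) (c := min c1 c2) (d := max d1 d2) (t0 := t0)
      ⟨min_lt_of_left_lt h1, lt_max_of_lt_left h2⟩
      (fun s hs => hy s (hIc.out hc hd (Ioo_subset_Icc_self hs)))
      (by rw [hy0]; exact hO0) (by rw [hy0]; exact hC0)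
    have htm : ∀ s ∈ ({t} : Set ℝ), s ∈ Ioo (min c1 c2) (max d1 d2) := by
      rintro s rfl
      exact ⟨min_lt_of_right_lt h3, lt_max_of_lt_right h4⟩
    exact ⟨fun s hs' => hs.hn1 s (htm s hs'), fun s hs' => hs.hn2 s (htm s hs'),
      fun s hs' => hs.hn3 s (htm s hs'), fun s hs' => hs.hSp s (htm s hs'),
      fun s hs' => hs.hSm s (htm s hs'), fun s hs' => hs.hO s (htm s hs'),
      fun s hs' => hs.hOnn s (htm s hs'), fun s hs' => hs.hcon s (htm s hs')⟩
  refine ⟨_, _, _, _, _, _, ⟨fun t ht => (hloc t ht).hn1 t rfl, fun t ht => (hloc t ht).hn2 t rfl,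
    fun t ht => (hloc t ht).hn3 t rfl, fun t ht => (hloc t ht).hSp t rfl,
    fun t ht => (hloc t ht).hSm t rfl, fun t ht => (hloc t ht).hO t rfl,
    fun t ht => (hloc t ht).hOnn t rfl, fun t ht => (hloc t ht).hcon t rfl⟩, fun t ht => ?_⟩
  have he := ode_unique (contDiff_vf γ) ht0 (fun s hs => hy s (hab hs))
    (fun s hs => h.vec_deriv hs) hy0 t ht
  simp only [he]
  exact ⟨rfl, rfl, rfl, rfl, rfl, rfl⟩

/-- global existence.  A solution on a bounded interval which is not of
Bianchi type IX extends to a solution on all of `ℝ`; a Bianchi type IX solution (all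
`Nᵢ` nonzero with the same sign) extends to the past, i.e. to a solution on `(-∞, b)`. -/
theorem existence_intervals
    (γ : ℝ) (hγ1 : 2/3 < γ) (hγ2 : γ ≤ 2)
    (O Sp Sm n1 n2 n3 : ℝ → ℝ) (a b : ℝ) (hab : a < b)
    (hsol : SolOn γ (Set.Ioo a b) O Sp Sm n1 n2 n3)
    (τ₀ : ℝ) (hτ₀ : τ₀ ∈ Set.Ioo a b) :
    (¬ ((0 < n1 τ₀ ∧ 0 < n2 τ₀ ∧ 0 < n3 τ₀) ∨ (n1 τ₀ < 0 ∧ n2 τ₀ < 0 ∧ n3 τ₀ < 0)) →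
      ∃ O' Sp' Sm' n1' n2' n3' : ℝ → ℝ,
        SolOn γ Set.univ O' Sp' Sm' n1' n2' n3' ∧
        ∀ τ ∈ Set.Ioo a b, O' τ = O τ ∧ Sp' τ = Sp τ ∧ Sm' τ = Sm τ ∧
          n1' τ = n1 τ ∧ n2' τ = n2 τ ∧ n3' τ = n3 τ) ∧
    (((0 < n1 τ₀ ∧ 0 < n2 τ₀ ∧ 0 < n3 τ₀) ∨ (n1 τ₀ < 0 ∧ n2 τ₀ < 0 ∧ n3 τ₀ < 0)) →
      ∃ O' Sp' Sm' n1' n2' n3' : ℝ → ℝ,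
        SolOn γ (Set.Iio b) O' Sp' Sm' n1' n2' n3' ∧
        ∀ τ ∈ Set.Ioo a b, O' τ = O τ ∧ Sp' τ = Sp τ ∧ Sm' τ = Sm τ ∧
          n1' τ = n1 τ ∧ n2' τ = n2 τ ∧ n3' τ = n3 τ) := by
  refine ⟨fun hn => ?_, fun hn => ?_⟩
  · refine hsol.extend hτ₀ isOpen_univ ordConnected_univ (subset_univ _) ?_
    intro c d _ _ hcd
    refine ⟨1 + (|n1 τ₀| + |n2 τ₀| + |n3 τ₀|) * Real.exp (8 * 1 * (d - c)), ?_⟩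
    intro c' d' h1 h2 h3 P Tp Tm m1 m2 m3 hs h0 t ht
    have e1 : m1 τ₀ = n1 τ₀ := congrFun h0 3
    have e2 : m2 τ₀ = n2 τ₀ := congrFun h0 4
    have e3 : m3 τ₀ = n3 τ₀ := congrFun h0 5
    rw [← e1, ← e2, ← e3] at hn ⊢
    refine hs.bound hγ1 hγ2 h3 ht le_rfl ?_ ?_
    · rw [abs_le]; constructor <;> linarith [h3.1, h3.2, ht.1, ht.2]
    · intro s hs'
      have hsm : s ∈ Ioo c' d' := ordConnected_Ioo.uIcc_subset h3 ht hs'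
      have hk := curv_nonneg (fun h => hn ((hs.type_iff h3 hsm).1 h))
      have hc := hs.hcon s hsm
      unfold Constraint at hc
      linarith
  · refine hsol.extend hτ₀ isOpen_Iio ordConnected_Iio Ioo_subset_Iio_self ?_
    intro c d _ hd hcd
    obtain ⟨Rf, hRf⟩ := (isCompact_Icc (a := τ₀) (b := d)).exists_bound_of_continuousOn
      (f := vec O Sp Sm n1 n2 n3) (fun s hs => (hsol.vec_deriv
        ⟨hτ₀.1.trans_le hs.1, hs.2.trans_lt hd⟩).continuousAt.continuousWithinAt)
    set B : ℝ := 6 + 3 * |n1 τ₀ * n2 τ₀ * n3 τ₀| with hB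
    refine ⟨max Rf (B + (|n1 τ₀| + |n2 τ₀| + |n3 τ₀|) * Real.exp (8 * B * (d - c))), ?_⟩
    intro c' d' h1 h2 h3 P Tp Tm m1 m2 m3 hs h0 t ht
    rcases le_total t τ₀ with htt | htt
    · refine le_trans ?_ (le_max_right _ _)
      have e1 : m1 τ₀ = n1 τ₀ := congrFun h0 3
      have e2 : m2 τ₀ = n2 τ₀ := congrFun h0 4
      have e3 : m3 τ₀ = n3 τ₀ := congrFun h0 5
      rw [← e1, ← e2, ← e3] at hn hB ⊢
      refine hs.bound hγ1 hγ2 h3 ht ?_ ?_ ?_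
      · have := abs_nonneg (m1 τ₀ * m2 τ₀ * m3 τ₀)
        linarith
      · rw [abs_le]; constructor <;> linarith [h3.1, h3.2, ht.1, ht.2]
      · intro s hs'
        have hsm : s ∈ Ioo c' d' := ordConnected_Ioo.uIcc_subset h3 ht hs'
        rw [uIcc_of_ge htt] at hs'
        have hk := curv_lower ((hs.type_iff h3 hsm).2 hn)
        have hp := hs.prod_le hγ1 hγ2 h3 hsm hs'.2
        have hc := hs.hcon s hsm
        unfold Constraint at hc
        linarith
    · refine le_trans ?_ (le_max_left _ _)
      have he := ode_unique (contDiff_vf γ) (c := max a c') (d := d')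
        ⟨max_lt hτ₀.1 h3.1, h3.2⟩
        (fun s hs' => hs.vec_deriv ⟨(max_lt_iff.1 hs'.1).2, hs'.2⟩)
        (fun s hs' => hsol.vec_deriv ⟨(max_lt_iff.1 hs'.1).1, hs'.2.trans (h2.trans_lt hd)⟩)
        h0 t ⟨max_lt (hτ₀.1.trans_le htt) ht.1, ht.2⟩
      rw [he]
      exact hRf t ⟨htt, (ht.2.trans_le h2).le⟩

end WainwrightHsu
end
end
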